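/- Let λ > 0, p > 0, q > 0, τ ∈ ℝ, −1 ≤ δ < p−1, let a ∈ A^τ_δ(ℝ), let χ ∈ S(ℝ) with χ(0) = 1, let 0 < ε < 1, set χ_ε(x) := χ(εx) with k-th derivative χ_ε^{(k)}, and fix an integer k ≥ 0. Then: (a) if q > p, for every integer l with 0 ≤ l ≤ [q/p), the function x ↦ e^{iλx^p} (L*)^l (x^{q−1} a(x) χ_ε^{(k)}(x)) is absolutely Lebesgue integrable on (0,∞); (b) for arbitrary p > 0 and q > 0, if ψ := 1 − φ for a cut-off function φ, then for every integer l ≥ 0 the function x ↦ e^{iλx^p} (L*)^l (x^{q−1} a(x) ψ(x) χ_ε^{(k)}(x)) is absolutely Lebesgue integrable on (0,∞). -/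

import Mathlib

open MeasureTheory Filter Topology Set

/-- The amplitude class `A^τ_δ(ℝ)`. -/
def AmpClass (τ δ : ℝ) (a : ℝ → ℂ) : Prop :=
  ContDiff ℝ (⊤ : ℕ∞) a ∧ ∀ k : ℕ, ∃ C : ℝ, 0 < C ∧ ∀ x : ℝ,
    ‖iteratedDeriv k a x‖ ≤ C * (1 + x ^ 2) ^ ((τ + δ * k) / 2)

/-- A cut-off function: smooth, `≡ 1` on `{|x| ≤ r₀}` for some `r₀ ≥ 1` and `≡ 0` on
`{|x| ≥ r₁}` for some `r₁ > r₀`. -/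
def IsCutoff (φ : ℝ → ℂ) : Prop :=
  ContDiff ℝ (⊤ : ℕ∞) φ ∧ ∃ r₀ r₁ : ℝ, 1 ≤ r₀ ∧ r₀ < r₁ ∧
    (∀ x : ℝ, |x| ≤ r₀ → φ x = 1) ∧ ∀ x : ℝ, r₁ ≤ |x| → φ x = 0

/-- The formal adjoint operator `L* g (x) = -(1/(iλ)) d/dx [ g(x) / (p x^{p-1}) ]`. -/
noncomputable def Lstar (lam p : ℝ) (g : ℝ → ℂ) : ℝ → ℂ :=
  fun x => -(1 / (Complex.I * lam)) * deriv (fun y => g y / ((p * y ^ (p - 1) : ℝ) : ℂ)) x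

/-- Amplitudes are of temperate growth. -/
theorem AmpClass.hasTemperateGrowth {τ δ : ℝ} {a : ℝ → ℂ} (ha : AmpClass τ δ a) :
    a.HasTemperateGrowth := by
  refine ⟨ha.1, fun n => ?_⟩
  obtain ⟨C, hC, h⟩ := ha.2 n
  obtain ⟨m, hm⟩ := exists_nat_ge ((τ + δ * n) / 2)
  refine ⟨2 * m, C, fun x => ?_⟩
  rw [norm_iteratedFDeriv_eq_norm_iteratedDeriv]
  refine (h x).trans (mul_le_mul_of_nonneg_left ?_ hC.le)
  have h1 : (1 : ℝ) ≤ 1 + x ^ 2 := by nlinarith [sq_nonneg x]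
  calc (1 + x ^ 2) ^ ((τ + δ * n) / 2) ≤ (1 + x ^ 2) ^ (m : ℝ) :=
        Real.rpow_le_rpow_of_exponent_le h1 hm
    _ = (1 + x ^ 2) ^ m := Real.rpow_natCast _ _
    _ ≤ ((1 + ‖x‖) ^ 2) ^ m := by
        refine pow_le_pow_left₀ (by positivity) ?_ m
        rw [Real.norm_eq_abs]
        nlinarith [abs_nonneg x, sq_abs x]
    _ = (1 + ‖x‖) ^ (2 * m) := (pow_mul _ _ _).symm

/-- Cut-off functions are of temperate growth. -/
theorem IsCutoff.hasTemperateGrowth {φ : ℝ → ℂ} (hφ : IsCutoff φ) : φ.HasTemperateGrowth := by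
  obtain ⟨hsm, r₀, r₁, -, -, -, h0⟩ := hφ
  have hc : HasCompactSupport φ := by
    refine HasCompactSupport.intro (isCompact_closedBall (0 : ℝ) r₁) fun x hx => h0 x ?_
    rw [Metric.mem_closedBall, dist_zero_right, Real.norm_eq_abs] at hx
    exact (not_le.1 hx).le
  exact (hc.toSchwartzMap hsm).hasTemperateGrowth

/-- Iterated derivatives of Schwartz functions are Schwartz functions. -/
theorem SchwartzMap.exists_coe_eq_iteratedDeriv (f : SchwartzMap ℝ ℂ) (k : ℕ) :
    ∃ g : SchwartzMap ℝ ℂ, (g : ℝ → ℂ) = iteratedDeriv k f := by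
  induction k with
  | zero => exact ⟨f, by simp⟩
  | succ k ih =>
    obtain ⟨g, hg⟩ := ih
    refine ⟨SchwartzMap.derivCLM ℂ ℂ g, ?_⟩
    ext x
    rw [SchwartzMap.derivCLM_apply, hg, iteratedDeriv_succ]

/-- Dilates of Schwartz functions are Schwartz functions. -/
theorem SchwartzMap.exists_coe_eq_comp_mul_left (f : SchwartzMap ℝ ℂ) {ε : ℝ} (hε : ε ≠ 0) :
    ∃ g : SchwartzMap ℝ ℂ, (g : ℝ → ℂ) = fun x => f (ε * x) :=
  ⟨SchwartzMap.compCLMOfContinuousLinearEquiv ℂ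
    (ContinuousLinearEquiv.unitsEquivAut ℝ (Units.mk0 ε hε)) f, by
      ext x; simp [mul_comm]⟩

/-- The values of `Lstar lam p f` on `(0,∞)` depend only on the values of `f` there. -/
theorem Lstar_congr_Ioi (lam p : ℝ) {f g : ℝ → ℂ} (h : EqOn f g (Ioi 0)) :
    EqOn (Lstar lam p f) (Lstar lam p g) (Ioi 0) := by
  intro x hx
  have : (fun y => f y / ((p * y ^ (p - 1) : ℝ) : ℂ)) =ᶠ[𝓝 x]
      fun y => g y / ((p * y ^ (p - 1) : ℝ) : ℂ) := by
    filter_upwards [Ioi_mem_nhds hx] with y hy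
    rw [h hy]
  simp only [Lstar, this.deriv_eq]

/-- `L*` maps `x ^ s * g` to `x ^ (s - p)` times a first-order Euler operator applied to `g`. -/
theorem Lstar_rpow_mul (lam : ℝ) {p : ℝ} (hp : p ≠ 0) (s : ℝ) {g : ℝ → ℂ}
    (hg : Differentiable ℝ g) {x : ℝ} (hx : 0 < x) :
    Lstar lam p (fun y => ((y ^ s : ℝ) : ℂ) * g y) x =
      ((x ^ (s - p) : ℝ) : ℂ) * (-(1 / (Complex.I * lam)) * (1 / p) *
        ((s - (p - 1)) * g x + x * deriv g x)) := by
  have hev : (fun y => ((y ^ s : ℝ) : ℂ) * g y / ((p * y ^ (p - 1) : ℝ) : ℂ)) =ᶠ[𝓝 x]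
      fun y => (1 / p : ℂ) * (((y ^ (s - (p - 1)) : ℝ) : ℂ) * g y) := by
    filter_upwards [Ioi_mem_nhds hx] with y hy
    have hy0 : ((y ^ (p - 1) : ℝ) : ℂ) ≠ 0 :=
      Complex.ofReal_ne_zero.2 (Real.rpow_pos_of_pos hy _).ne'
    have hp0 : (p : ℂ) ≠ 0 := Complex.ofReal_ne_zero.2 hp
    rw [Real.rpow_sub hy s (p - 1)]
    push_cast
    field_simp
  have hd := ((Real.hasDerivAt_rpow_const (p := s - (p - 1)) (Or.inl hx.ne')).ofReal_comp.mul
    (hg x).hasDerivAt).const_mul (1 / p : ℂ)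
  have e1 : s - (p - 1) - 1 = s - p := by ring
  have e2 : x ^ (s - (p - 1)) = x ^ (s - p) * x := by
    rw [← Real.rpow_add_one hx.ne']; congr 1; ring
  rw [Lstar, (hd.congr_of_eventuallyEq hev).deriv, e1, e2]
  push_cast
  ring

/-- On `(0,∞)`, `(L*)^l (x ^ s * g)` is `x ^ (s - l * p)` times a Schwartz function which
vanishes on `(0,1)` whenever `g` does. -/
theorem exists_Lstar_iterate_eqOn (lam : ℝ) {p : ℝ} (hp : p ≠ 0) (s : ℝ) (g : SchwartzMap ℝ ℂ)
    (l : ℕ) : ∃ h : SchwartzMap ℝ ℂ,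
      EqOn ((Lstar lam p)^[l] fun y => ((y ^ s : ℝ) : ℂ) * g y)
        (fun y => ((y ^ (s - l * p) : ℝ) : ℂ) * h y) (Ioi 0) ∧
      (EqOn g 0 (Ioo 0 1) → EqOn h 0 (Ioo 0 1)) := by
  induction l with
  | zero => exact ⟨g, by intro x _; simp, id⟩
  | succ l ih =>
    obtain ⟨h, heq, hz⟩ := ih
    have hid : (fun x : ℝ => (x : ℂ)).HasTemperateGrowth :=
      Complex.ofRealCLM.hasTemperateGrowth
    refine ⟨(-(1 / (Complex.I * lam)) * (1 / p) : ℂ) •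
      (((s - l * p : ℝ) - (p - 1) : ℂ) • h + SchwartzMap.smulLeftCLM ℂ (fun x : ℝ => (x : ℂ))
        (SchwartzMap.derivCLM ℂ ℂ h)), fun x hx => ?_, fun h0 x hx => ?_⟩
    · rw [Function.iterate_succ_apply', Lstar_congr_Ioi lam p heq hx,
        Lstar_rpow_mul lam hp _ h.differentiable hx]
      have e : s - l * p - p = s - (l + 1 : ℕ) * p := by push_cast; ring
      simp [e, SchwartzMap.smulLeftCLM_apply_apply hid, mul_add]
    · have hev : (h : ℝ → ℂ) =ᶠ[𝓝 x] fun _ => 0 :=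
        (hz h0).eventuallyEq_of_mem (Ioo_mem_nhds hx.1 hx.2)
      simp [SchwartzMap.smulLeftCLM_apply_apply hid, hev.eq_of_nhds, hev.deriv_eq]

/-- A Schwartz function times a power is integrable on `(0,∞)` if it is so near `0`. -/
theorem SchwartzMap.integrableOn_rpow_mul (h : SchwartzMap ℝ ℂ) {r b : ℝ} (hb : b < r + 1)
    (h0 : h =O[𝓝[>] 0] fun x : ℝ => x ^ (-b)) :
    IntegrableOn (fun x : ℝ => ((x ^ r : ℝ) : ℂ) * h x) (Ioi 0) := by
  have htop : h =O[atTop] fun x : ℝ => x ^ (-(r + 2)) := by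
    refine ((h.isBigO_cocompact_rpow (-(r + 2))).mono atTop_le_cocompact).congr' .rfl ?_
    filter_upwards [eventually_ge_atTop 0] with x hx
    rw [Real.norm_of_nonneg hx]
  have hM : MellinConvergent h ((r + 1 : ℝ) : ℂ) :=
    mellinConvergent_of_isBigO_rpow (h.continuous.locallyIntegrable.locallyIntegrableOn _) htop
      (by rw [Complex.ofReal_re]; linarith) h0 (by rwa [Complex.ofReal_re])
  refine hM.congr_fun (fun x hx => ?_) measurableSet_Ioi
  have e : ((r + 1 : ℝ) : ℂ) - 1 = (r : ℂ) := by push_cast; ring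
  simp only [e, smul_eq_mul, Complex.ofReal_cpow (le_of_lt hx)]

/-- Multiplication by the phase factor preserves integrability. -/
theorem integrableOn_exp_phase_mul (lam p : ℝ) {f : ℝ → ℂ} {s : Set ℝ} (hf : IntegrableOn f s) :
    IntegrableOn (fun x : ℝ => Complex.exp (Complex.I * lam * ((x ^ p : ℝ) : ℂ)) * f x) s := by
  refine Integrable.bdd_mul (c := 1) hf ?_ (Eventually.of_forall fun x => ?_)
  · exact Measurable.aestronglyMeasurable (by fun_prop)
  · rw [mul_assoc, ← Complex.ofReal_mul, mul_comm, Complex.norm_exp_ofReal_mul_I]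

/-- Integrability of `e^{iλx^p} (L*)^l (x^{q-1} g)` for Schwartz `g`, provided `l p < q` or `g`
vanishes on `(0,1)`. -/
theorem integrableOn_exp_mul_Lstar_iterate (lam : ℝ) {p : ℝ} (hp : p ≠ 0) (q : ℝ)
    (g : SchwartzMap ℝ ℂ) (l : ℕ) (hgl : l * p < q ∨ EqOn g 0 (Ioo 0 1)) :
    IntegrableOn (fun x : ℝ => Complex.exp (Complex.I * lam * ((x ^ p : ℝ) : ℂ)) *
      (Lstar lam p)^[l] (fun y => ((y ^ (q - 1) : ℝ) : ℂ) * g y) x) (Ioi 0) := by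
  obtain ⟨h, heq, hz⟩ := exists_Lstar_iterate_eqOn lam hp (q - 1) g l
  refine integrableOn_exp_phase_mul lam p
    (IntegrableOn.congr_fun ?_ heq.symm measurableSet_Ioi)
  rcases hgl with hl | h0
  · refine h.integrableOn_rpow_mul (b := 0) (by linarith) ?_
    simpa using (h.continuous.tendsto 0).isBigO_one ℝ |>.mono nhdsWithin_le_nhds
  · refine h.integrableOn_rpow_mul (lt_add_of_pos_right (q - 1 - l * p) one_pos) ?_
    refine (Asymptotics.isBigO_zero _ _).congr' ?_ .rfl
    filter_upwards [Ioo_mem_nhdsGT (zero_lt_one (α := ℝ))] with x hx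
    exact (hz h0 hx).symm

/-- **Absolute integrability after applying the iterated formal adjoint.**
(a) If `q > p`, then for `0 ≤ l ≤ [q/p)` (the greatest integer `< q/p`, i.e. `⌈q/p⌉ - 1`),
`x ↦ e^{iλx^p} (L*)^l (x^{q-1} a(x) χ_ε^{(k)}(x))` is absolutely integrable on `(0,∞)`.
(b) For arbitrary `p, q > 0` and `ψ = 1 - φ` with `φ` a cut-off function, the same holds
for every `l ≥ 0` with `a` replaced by `aψ`. -/
theorem Lstar_integrable (lam p q τ δ : ℝ) (hlam : 0 < lam) (hp : 0 < p) (hq : 0 < q)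
    (hδ₁ : -1 ≤ δ) (hδ₂ : δ < p - 1) (a : ℝ → ℂ) (ha : AmpClass τ δ a)
    (χ : SchwartzMap ℝ ℂ) (hχ : χ 0 = 1) (ε : ℝ) (hε₀ : 0 < ε) (hε₁ : ε < 1) (k : ℕ) :
    (p < q → ∀ l : ℕ, (l : ℤ) ≤ ⌈q / p⌉ - 1 →
      IntegrableOn
        (fun x : ℝ => Complex.exp (Complex.I * lam * ((x ^ p : ℝ) : ℂ)) *
          (Lstar lam p)^[l]
            (fun y => ((y ^ (q - 1) : ℝ) : ℂ) * a y *
              iteratedDeriv k (fun z => χ (ε * z)) y) x)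
        (Set.Ioi 0)) ∧
    (∀ φ : ℝ → ℂ, IsCutoff φ → ∀ l : ℕ,
      IntegrableOn
        (fun x : ℝ => Complex.exp (Complex.I * lam * ((x ^ p : ℝ) : ℂ)) *
          (Lstar lam p)^[l]
            (fun y => ((y ^ (q - 1) : ℝ) : ℂ) * a y * (1 - φ y) *
              iteratedDeriv k (fun z => χ (ε * z)) y) x)
        (Set.Ioi 0)) := by
  obtain ⟨χε, hχε⟩ := χ.exists_coe_eq_comp_mul_left hε₀.ne'
  obtain ⟨f, hf⟩ := χε.exists_coe_eq_iteratedDeriv k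
  rw [hχε] at hf
  have hA := ha.hasTemperateGrowth
  refine ⟨fun _ l hl => ?_, fun φ hφ l => ?_⟩
  · have hlq : l * p < q := by
      have : ((l : ℤ) : ℝ) < q / p := Int.lt_ceil.1 (by omega)
      rwa [lt_div_iff₀ hp, Int.cast_natCast] at this
    have := integrableOn_exp_mul_Lstar_iterate lam hp.ne' q (SchwartzMap.smulLeftCLM ℂ a f) l
      (Or.inl hlq)
    simpa only [SchwartzMap.smulLeftCLM_apply_apply hA, smul_eq_mul, hf, ← mul_assoc] using this
  · have hB : (fun y => 1 - φ y).HasTemperateGrowth :=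
      (Function.HasTemperateGrowth.const 1).sub hφ.hasTemperateGrowth
    have hz : EqOn (SchwartzMap.smulLeftCLM ℂ a
        (SchwartzMap.smulLeftCLM ℂ (fun y => 1 - φ y) f)) 0 (Ioo 0 1) := by
      obtain ⟨-, r₀, r₁, hr₀, -, h1, -⟩ := hφ
      intro x hx
      have : φ x = 1 := h1 x (by rw [abs_of_pos hx.1]; exact hx.2.le.trans hr₀)
      simp [SchwartzMap.smulLeftCLM_apply_apply hA, SchwartzMap.smulLeftCLM_apply_apply hB, this]
    have := integrableOn_exp_mul_Lstar_iterate lam hp.ne' q _ l (Or.inr hz)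
    simpa only [SchwartzMap.smulLeftCLM_apply_apply hA, SchwartzMap.smulLeftCLM_apply_apply hB,
      smul_eq_mul, hf, ← mul_assoc] using this
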